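/- For all integers n ≥ 4 and p ≥ 0, (Σ_{i=0}^{p} C(p,i) B_{n+i+1}) · (Σ_{ℓ=0}^{p} C(p,ℓ) (B_{n+ℓ−1} − B_{n+ℓ−2})) > (Σ_{i=0}^{p} C(p,i) B_{n+i}) · (Σ_{ℓ=0}^{p} C(p,ℓ) (B_{n+ℓ} − B_{n+ℓ−1})), where C(p,i) is the binomial coefficient and B_k is the k-th Bell number. -/

import Mathlib

open Finset SimpleGraph

/-- A coloring partition of `G`: a partition of the vertex set into (nonempty)
independent (stable) sets. -/
def IsStablePartition {V : Type*} [Fintype V] [DecidableEq V] (G : SimpleGraph V)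
    (P : Finpartition (univ : Finset V)) : Prop :=
  ∀ t ∈ P.parts, ∀ u ∈ t, ∀ v ∈ t, ¬ G.Adj u v

open scoped Classical in
/-- `colB G` : the number of coloring partitions of `G`. -/
noncomputable def colB {V : Type*} [Fintype V] [DecidableEq V] (G : SimpleGraph V) : ℕ :=
  (univ.filter (IsStablePartition G)).card

open scoped Classical in
/-- `colT G` : the total number of blocks summed over all coloring partitions of `G`. -/
noncomputable def colT {V : Type*} [Fintype V] [DecidableEq V] (G : SimpleGraph V) : ℕ :=
  ∑ P ∈ univ.filter (IsStablePartition G), P.parts.card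

/-- `colA G = colT G / colB G` : the average number of blocks. -/
noncomputable def colA {V : Type*} [Fintype V] [DecidableEq V] (G : SimpleGraph V) : ℚ :=
  (colT G : ℚ) / (colB G : ℚ)

/-- The `n`-th Bell number: the number of partitions of an `n`-element set. -/
noncomputable def bell (n : ℕ) : ℕ :=
  Fintype.card (Finpartition (univ : Finset (Fin n)))

/-- The disjoint union of `G` with `p` isolated vertices (`G ∪ pK₁`). -/
def unionIsolated {V : Type*} (G : SimpleGraph V) (p : ℕ) : SimpleGraph (V ⊕ Fin p) :=
  SimpleGraph.fromRel (fun x y => ∃ a b, x = Sum.inl a ∧ y = Sum.inl b ∧ G.Adj a b)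

/-- `Hgraph n r` : the graph obtained from the disjoint union of the cycle `C_n` and the
path `P_r` by adding an edge between one endpoint of the path (vertex `0`) and one vertex
of the cycle (vertex `0`). -/
def Hgraph (n r : ℕ) : SimpleGraph (Fin n ⊕ Fin r) :=
  SimpleGraph.fromRel (fun x y =>
    (∃ a b, x = Sum.inl a ∧ y = Sum.inl b ∧ (cycleGraph n).Adj a b) ∨
    (∃ a b, x = Sum.inr a ∧ y = Sum.inr b ∧ (pathGraph r).Adj a b) ∨
    (∃ (a : Fin n) (b : Fin r), a.val = 0 ∧ b.val = 0 ∧ x = Sum.inl a ∧ y = Sum.inr b))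


/-- A function on `Fin n` is the same as a partition of `Fin n` together with an injective
labelling of its parts. -/
theorem card_pow_eq_sum_descFactorial (n m : ℕ) :
    m ^ n = ∑ P : Finpartition (univ : Finset (Fin n)), m.descFactorial #P.parts := by
  classical
  let F : (Σ P : Finpartition (univ : Finset (Fin n)), P.parts ↪ Fin m) → (Fin n → Fin m) :=
    fun x i => x.2 ⟨x.1.part i, x.1.part_mem.2 (mem_univ i)⟩
  have hF : Function.Bijective F := by
    constructor
    · rintro ⟨P, g⟩ ⟨Q, h⟩ hPQ
      have hfun (i : Fin n) : g ⟨P.part i, P.part_mem.2 (mem_univ i)⟩ =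
          h ⟨Q.part i, Q.part_mem.2 (mem_univ i)⟩ := congrFun hPQ i
      have hpart (i : Fin n) : P.part i = Q.part i := by
        ext j
        rw [P.mem_part_iff_part_eq_part (mem_univ _) (mem_univ _),
          Q.mem_part_iff_part_eq_part (mem_univ _) (mem_univ _)]
        have hP := g.injective.eq_iff (a := ⟨P.part j, P.part_mem.2 (mem_univ j)⟩)
          (b := ⟨P.part i, P.part_mem.2 (mem_univ i)⟩)
        have hQ := h.injective.eq_iff (a := ⟨Q.part j, Q.part_mem.2 (mem_univ j)⟩)
          (b := ⟨Q.part i, Q.part_mem.2 (mem_univ i)⟩)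
        rw [Subtype.mk.injEq] at hP hQ
        rw [← hP, ← hQ, hfun, hfun]
      have hparts (R : Finpartition (univ : Finset (Fin n))) (t : Finset (Fin n)) :
          t ∈ R.parts ↔ ∃ i, R.part i = t := by
        constructor
        · intro ht
          obtain ⟨i, -, hi⟩ := R.part_surjOn ht
          exact ⟨i, hi⟩
        · rintro ⟨i, rfl⟩
          exact R.part_mem.2 (mem_univ i)
      obtain rfl : P = Q := by
        ext t
        simp only [hparts, hpart]
      congr 1
      ext ⟨t, ht⟩ : 1
      obtain ⟨i, rfl⟩ := (hparts P t).1 ht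
      exact hfun i
    · intro f
      let P := Finpartition.ofSetoid (Setoid.ker f)
      have hP (i j : Fin n) : P.part i = P.part j ↔ f i = f j := by
        rw [← P.mem_part_iff_part_eq_part (mem_univ _) (mem_univ _),
          Finpartition.mem_part_ofSetoid_iff_rel, Setoid.ker_def, eq_comm]
      have hrep (t : P.parts) : ∃ i, P.part i = t.1 := by
        obtain ⟨i, -, hi⟩ := P.part_surjOn t.2
        exact ⟨i, hi⟩
      choose r hr using hrep
      refine ⟨⟨P, ⟨fun t => f (r t), fun s t hst => ?_⟩⟩, ?_⟩
      · exact Subtype.ext (by rw [← hr s, ← hr t]; exact (hP _ _).2 hst)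
      · funext i
        exact (hP _ _).1 (hr _)
  have hcard := Fintype.card_of_bijective hF
  simpa [Fintype.card_sigma, Fintype.card_embedding_eq] using hcard.symm

theorem hasSum_descFactorial_div_factorial (k : ℕ) :
    HasSum (fun m : ℕ => (m.descFactorial k : ℝ) / m.factorial) (Real.exp 1) := by
  rw [← hasSum_nat_add_iff' k, Finset.sum_eq_zero, sub_zero]
  · have h := NormedSpace.expSeries_div_hasSum_exp (1 : ℝ)
    rw [← Real.exp_eq_exp_ℝ] at h
    convert! h using 1
    funext m
    have hm := Nat.factorial_mul_descFactorial (Nat.le_add_left k m)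
    rw [Nat.add_sub_cancel] at hm
    rw [← hm]
    have h₁ : ((m + k).descFactorial k : ℝ) ≠ 0 := by
      rw [Nat.cast_ne_zero, Ne, Nat.descFactorial_eq_zero_iff_lt]
      omega
    have h₂ : (m.factorial : ℝ) ≠ 0 := by positivity
    push_cast
    field_simp
    simp
  · intro m hm
    simp [Nat.descFactorial_eq_zero_iff_lt.2 (Finset.mem_range.1 hm)]

/-- Dobiński's formula. -/
theorem hasSum_pow_div_factorial (n : ℕ) :
    HasSum (fun m : ℕ => (m : ℝ) ^ n / m.factorial) (Real.exp 1 * bell n) := by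
  have h := hasSum_sum (s := (univ : Finset (Finpartition (univ : Finset (Fin n)))))
    fun P _ => hasSum_descFactorial_div_factorial #P.parts
  convert! h using 1
  · funext m
    rw [← Finset.sum_div]
    exact_mod_cast congrArg (fun a : ℕ => (a : ℝ) / m.factorial) (card_pow_eq_sum_descFactorial n m)
  · simp [bell, mul_comm]

theorem hasSum_pow_mul_add_one_pow_div_factorial (n p : ℕ) :
    HasSum (fun m : ℕ => (m : ℝ) ^ n * (m + 1) ^ p / m.factorial)
      (Real.exp 1 * ∑ i ∈ range (p + 1), (p.choose i : ℝ) * bell (n + i)) := by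
  have h := hasSum_sum (s := range (p + 1))
    fun i _ => (hasSum_pow_div_factorial (n + i)).mul_left (p.choose i : ℝ)
  convert! h using 1
  · funext m
    rw [add_pow, Finset.mul_sum, Finset.sum_div]
    refine Finset.sum_congr rfl fun i _ => ?_
    rw [pow_add]
    ring
  · rw [Finset.mul_sum]
    exact Finset.sum_congr rfl fun i _ => by ring

/-- Cauchy–Schwarz for consecutive moments of a nonnegative weight. -/
theorem sq_moment_le {ι : Type*} {v a : ι → ℝ} {x y z : ℝ} (hv : ∀ j, 0 ≤ v j)
    (hx : HasSum v x) (hy : HasSum (fun j => a j * v j) y)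
    (hz : HasSum (fun j => a j ^ 2 * v j) z) : y ^ 2 ≤ x * z := by
  have h (c : ℝ) : 0 ≤ x * (c * c) + (-2 * y) * c + z := by
    have h₁ := ((hx.mul_left (c * c)).add (hy.mul_left (-2 * c))).add hz
    have h₂ := h₁.nonneg fun j => by nlinarith [mul_nonneg (sq_nonneg (a j - c)) (hv j)]
    linarith
  have := discrim_le_zero h
  rw [discrim] at this
  linarith

/-- The moment inequality for a weight on `{1, 2, 3, 4}` together with a tail, where `s k` is
the `k`-th moment of the whole weight and the tail gives mass `v j` to the point `j + 5`. -/
theorem moment_inequality {w₁ w₂ w₃ w₄ : ℝ} {v : ℕ → ℝ} {s : ℕ → ℝ}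
    (hw₃ : 0 ≤ w₃) (hw₄ : 0 ≤ w₄) (hv : ∀ j, 0 ≤ v j)
    (hw₁ : 0 ≤ w₁) (hw₁₂ : 2 * w₁ ≤ w₂)
    (hw : 0 < w₂ * w₃ + 8 * w₂ * w₄ + 5 * w₃ * w₄ - w₁ * w₂ - 4 * w₁ * w₃ - 9 * w₁ * w₄)
    (hs : ∀ k, HasSum (fun j : ℕ => ((j : ℝ) + 5) ^ k * v j)
      (s k - (w₁ + 2 ^ k * w₂ + 3 ^ k * w₃ + 4 ^ k * w₄))) :
    s 2 * (s 2 - s 1) < s 3 * (s 1 - s 0) := by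
  obtain ⟨q, hq⟩ : ∃ q : ℕ → ℝ, ∀ k, s k = q k + (w₁ + 2 ^ k * w₂ + 3 ^ k * w₃ + 4 ^ k * w₄) :=
    ⟨fun k => s k - (w₁ + 2 ^ k * w₂ + 3 ^ k * w₃ + 4 ^ k * w₄), fun k => by ring⟩
  simp only [hq, add_sub_cancel_right] at hs
  have h0 : HasSum v (q 0) := by simpa using hs 0
  have h1 : HasSum (fun j : ℕ => ((j : ℝ) + 3) * v j) (q 1 - 2 * q 0) := by
    convert! (hs 1).sub (h0.mul_left 2) using 2
    ring
  have h2 : HasSum (fun j : ℕ => ((j : ℝ) + 3) ^ 2 * v j) (q 2 - 4 * q 1 + 4 * q 0) := by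
    convert! ((hs 2).sub ((hs 1).mul_left 4)).add (h0.mul_left 4) using 2
    ring
  have h3 : HasSum (fun j : ℕ => ((j : ℝ) + 3) ^ 3 * v j)
      (q 3 - 6 * q 2 + 12 * q 1 - 8 * q 0) := by
    convert! (((hs 3).sub ((hs 2).mul_left 6)).add ((hs 1).mul_left 12)).sub
      (h0.mul_left 8) using 2
    ring
  obtain ⟨z₀, hz₀⟩ : ∃ z, z = q 0 := ⟨_, rfl⟩
  obtain ⟨z₁, hz₁⟩ : ∃ z, z = q 1 - 2 * q 0 := ⟨_, rfl⟩
  obtain ⟨z₂, hz₂⟩ : ∃ z, z = q 2 - 4 * q 1 + 4 * q 0 := ⟨_, rfl⟩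
  obtain ⟨z₃, hz₃⟩ : ∃ z, z = q 3 - 6 * q 2 + 12 * q 1 - 8 * q 0 := ⟨_, rfl⟩
  rw [← hz₀] at h0
  rw [← hz₁] at h1
  rw [← hz₂] at h2
  rw [← hz₃] at h3
  have n0 : 0 ≤ z₀ := h0.nonneg hv
  have n1 : 0 ≤ z₁ := h1.nonneg fun j => mul_nonneg (by positivity) (hv j)
  have n2 : 0 ≤ z₂ := h2.nonneg fun j => mul_nonneg (by positivity) (hv j)
  have n3 : 0 ≤ z₃ := h3.nonneg fun j => mul_nonneg (by positivity) (hv j)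
  have c1 : z₁ ^ 2 ≤ z₀ * z₂ := sq_moment_le hv h0 h1 h2
  have c2 : z₂ ^ 2 ≤ z₁ * z₃ := by
    refine sq_moment_le (fun j => mul_nonneg (by positivity) (hv j)) h1 ?_ ?_
      (a := fun j : ℕ => (j : ℝ) + 3)
    · convert! h2 using 2
      ring
    · convert! h3 using 2
      ring
  have c3 : z₁ * z₂ ≤ z₀ * z₃ := by
    rcases n1.eq_or_lt with h | p1
    · rw [← h, zero_mul]
      positivity
    rcases n2.eq_or_lt with h | p2
    · rw [← h, mul_zero]
      positivity
    have := mul_le_mul c1 c2 (by positivity) (by positivity)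
    refine le_of_mul_le_mul_right ?_ (mul_pos p1 p2)
    linarith
  have d₁ : 0 ≤ 2 * z₃ - z₂ - 2 * z₁ - z₀ := by
    have h := (((h3.mul_left 2).sub h2).sub (h1.mul_left 2)).sub h0
    refine h.nonneg fun j => ?_
    have : 0 ≤ (2 * ((j : ℝ) + 3) ^ 3 - (j + 3) ^ 2 - 2 * (j + 3) - 1) * v j :=
      mul_nonneg (by ring_nf; positivity) (hv j)
    linarith
  have d₃ : 0 ≤ 2 * z₃ - 3 * z₂ + z₀ := by
    have h := ((h3.mul_left 2).sub (h2.mul_left 3)).add h0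
    refine h.nonneg fun j => ?_
    have : 0 ≤ (2 * ((j : ℝ) + 3) ^ 3 - 3 * (j + 3) ^ 2 + 1) * v j :=
      mul_nonneg (by ring_nf; positivity) (hv j)
    linarith
  have d₄ : 0 ≤ 3 * z₃ - 10 * z₂ + 4 * z₁ + 8 * z₀ := by
    have h := (((h3.mul_left 3).sub (h2.mul_left 10)).add (h1.mul_left 4)).add (h0.mul_left 8)
    refine h.nonneg fun j => ?_
    have : 0 ≤ (3 * ((j : ℝ) + 3) ^ 3 - 10 * (j + 3) ^ 2 + 4 * (j + 3) + 8) * v j :=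
      mul_nonneg (by ring_nf; positivity) (hv j)
    linarith
  have e₁ := mul_nonneg hw₁ d₁
  have e₂ := mul_nonneg (sub_nonneg.2 hw₁₂) n3
  have e₃ := mul_nonneg hw₃ d₃
  have e₄ := mul_nonneg hw₄ d₄
  have q0 : q 0 = z₀ := hz₀.symm
  have q1 : q 1 = z₁ + 2 * z₀ := by linarith
  have q2 : q 2 = z₂ + 4 * z₁ + 4 * z₀ := by linarith
  have q3 : q 3 = z₃ + 6 * z₂ + 12 * z₁ + 8 * z₀ := by linarith
  simp only [hq, q0, q1, q2, q3]
  linarith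

theorem binomial_bell_inequality (m p : ℕ) :
    (∑ i ∈ range (p + 1), (p.choose i : ℝ) * bell (m + 4 + i)) *
      (∑ i ∈ range (p + 1), (p.choose i : ℝ) * bell (m + 4 + i) -
        ∑ i ∈ range (p + 1), (p.choose i : ℝ) * bell (m + 3 + i)) <
    (∑ i ∈ range (p + 1), (p.choose i : ℝ) * bell (m + 5 + i)) *
      (∑ i ∈ range (p + 1), (p.choose i : ℝ) * bell (m + 3 + i) -
        ∑ i ∈ range (p + 1), (p.choose i : ℝ) * bell (m + 2 + i)) := by
  let s : ℕ → ℝ := fun k =>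
    Real.exp 1 * ∑ i ∈ range (p + 1), (p.choose i : ℝ) * bell (m + 2 + k + i)
  let w : ℕ → ℝ := fun x => (x : ℝ) ^ (m + 2) * (x + 1) ^ p / x.factorial
  have hs (k : ℕ) : HasSum (fun x : ℕ => (x : ℝ) ^ k * w x) (s k) := by
    convert! hasSum_pow_mul_add_one_pow_div_factorial (m + 2 + k) p using 2 with x
    simp only [w]
    ring
  have hw₁ : w 1 = 2 ^ p := by norm_num [w]
  have hw₂ : w 2 = 2 * (2 ^ m * 3 ^ p) := by norm_num [w, pow_add, Nat.factorial]; ring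
  have hw₃ : w 3 = 3 / 2 * (3 ^ m * 4 ^ p) := by norm_num [w, pow_add, Nat.factorial]; ring
  have hw₄ : w 4 = 2 / 3 * (4 ^ m * 5 ^ p) := by norm_num [w, pow_add, Nat.factorial]; ring
  have hα : (2 : ℝ) ^ p ≤ 2 ^ m * 3 ^ p := by
    calc (2 : ℝ) ^ p = 1 * 2 ^ p := (one_mul _).symm
      _ ≤ 2 ^ m * 3 ^ p := by
        gcongr
        · exact one_le_pow₀ (by norm_num)
        · norm_num
  have hβ : (2 : ℝ) ^ m * 3 ^ p ≤ 3 ^ m * 4 ^ p := by gcongr <;> norm_num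
  have hγ : (3 : ℝ) ^ m * 4 ^ p ≤ 4 ^ m * 5 ^ p := by gcongr <;> norm_num
  have hq : (0 : ℝ) < 2 ^ p := by positivity
  have key : s 2 * (s 2 - s 1) < s 3 * (s 1 - s 0) := by
    refine moment_inequality (w₁ := w 1) (w₂ := w 2) (w₃ := w 3) (w₄ := w 4)
      (v := fun j => w (j + 5)) (by positivity) (by positivity) (fun j => by positivity)
      (by positivity) (by rw [hw₁, hw₂]; linarith) ?_ fun k => ?_
    · rw [hw₁, hw₂, hw₃, hw₄]
      generalize (2 : ℝ) ^ p = a at *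
      generalize (2 : ℝ) ^ m * 3 ^ p = b at *
      generalize (3 : ℝ) ^ m * 4 ^ p = c at *
      generalize (4 : ℝ) ^ m * 5 ^ p = d at *
      have hb : 0 < b := by linarith
      have hc : 0 < c := by linarith
      have hd : 0 < d := by linarith
      have t₁ := mul_nonneg hc.le (sub_nonneg.2 hα)
      have t₂ := mul_nonneg hd.le (sub_nonneg.2 hα)
      have t₃ := mul_nonneg hq.le (sub_nonneg.2 hβ)
      have t₄ := mul_nonneg hc.le (sub_nonneg.2 (hα.trans (hβ.trans hγ)))
      have t₅ := mul_pos hq hd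
      linarith
    · convert! (hasSum_nat_add_iff' 5).2 (hs k) using 2
      · push_cast
        rfl
      · rw [Finset.sum_range_succ', Finset.sum_range_succ, Finset.sum_range_succ,
          Finset.sum_range_succ, Finset.sum_range_one]
        norm_num [w]
  have he : 0 < Real.exp 1 * Real.exp 1 := by positivity
  refine lt_of_mul_lt_mul_left ?_ he.le
  simp only [s, add_zero, show m + 2 + 1 = m + 3 from rfl, show m + 2 + 2 = m + 4 from rfl,
    show m + 2 + 3 = m + 5 from rfl] at key
  linarith

/-- For all `n ≥ 4` and `p ≥ 0`,
`(∑ C(p,i) B_{n+i+1})(∑ C(p,ℓ)(B_{n+ℓ-1} - B_{n+ℓ-2})) >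
 (∑ C(p,i) B_{n+i})(∑ C(p,ℓ)(B_{n+ℓ} - B_{n+ℓ-1}))`. -/
theorem stmt_11 (n p : ℕ) (hn : 4 ≤ n) :
    (∑ i ∈ Finset.range (p + 1), (p.choose i : ℤ) * bell (n + i + 1)) *
      (∑ l ∈ Finset.range (p + 1), (p.choose l : ℤ) * ((bell (n + l - 1) : ℤ) - bell (n + l - 2))) >
    (∑ i ∈ Finset.range (p + 1), (p.choose i : ℤ) * bell (n + i)) *
      (∑ l ∈ Finset.range (p + 1), (p.choose l : ℤ) * ((bell (n + l) : ℤ) - bell (n + l - 1))) := by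
  obtain ⟨m, rfl⟩ := Nat.exists_eq_add_of_le' hn
  have h := binomial_bell_inequality m p
  have e₁ (i : ℕ) : m + 4 + i + 1 = m + 5 + i := by omega
  have e₂ (i : ℕ) : m + 4 + i - 1 = m + 3 + i := by omega
  have e₃ (i : ℕ) : m + 4 + i - 2 = m + 2 + i := by omega
  simp only [e₁, e₂, e₃, mul_sub, Finset.sum_sub_distrib]
  rw [← mul_sub, ← mul_sub, gt_iff_lt]
  exact_mod_cast h
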